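/- arXiv:1705.10459 — 4 statements merged into one kernel-verified Lean document; each statement's English description precedes it below -/
import Mathlib

section
/- Let N ≥ 1, let λ ∈ ℝ^N have positive entries, let μ > 0, q ∈ {1/2, 1}, set ρ_i := 1 − 4μλ_i + 8qμ²λ_i², F := diag(ρ) + 4μ²λλᵀ, and Λ := diag(λ). Assume ρ_i ≥ 0 for all i, that F is positive definite, and that all eigenvalues of F are strictly less than 1. Let ε* ∈ ℝ^N have nonnegative entries and let S : ℕ → ℝ^{N×N} have entrywise nonnegative values and satisfy S[n+1] = F·S[n] + 4μ²·λ·ε*ᵀ for all n ≥ n₀; define ε[n]ᵀ := 1ᵀ·Λ·S[n] + ε*ᵀ. Then for all n ≥ n₀: ‖ε[n]‖_∞ ≤ (max_i λ_i / min_i λ_i)·(‖F‖₁)^{n−n₀}·‖ε[n₀]‖_∞ + (1 + 4μ²·λᵀ(I−F)⁻¹λ)·‖ε*‖_∞. -/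
open Finset Matrix

lemma aux_posDef {N : ℕ} (F : Matrix (Fin N) (Fin N) ℝ) (hF : F.IsHermitian)
    (heig : ∀ t ∈ spectrum ℝ F, t < 1) : (1 - F).PosDef := by
  have hH : (1 - F).IsHermitian := Matrix.isHermitian_one.sub hF
  rw [hH.posDef_iff_eigenvalues_pos]
  intro i
  have h1 : hH.eigenvalues i ∈ spectrum ℝ (1 - F) := hH.eigenvalues_mem_spectrum_real i
  have h2 : 1 - hH.eigenvalues i ∈ spectrum ℝ F := by
    rw [spectrum.mem_iff] at h1 ⊢
    intro h
    apply h1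
    have : algebraMap ℝ (Matrix (Fin N) (Fin N) ℝ) (hH.eigenvalues i) - (1 - F)
        = -(algebraMap ℝ (Matrix (Fin N) (Fin N) ℝ) (1 - hH.eigenvalues i) - F) := by
      rw [map_sub, map_one]; abel
    rw [this]
    exact h.neg
  have := heig _ h2
  linarith

lemma aux_nonneg {N : ℕ} (F : Matrix (Fin N) (Fin N) ℝ) (hF : F.IsHermitian)
    (h1 : (1 - F).PosDef) (lam w : Fin N → ℝ) (hw : (1 - F) *ᵥ w = lam)
    (hl : ∀ i, 0 ≤ lam i) (hFn : ∀ i j, 0 ≤ F i j) (k : ℕ) :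
    0 ≤ lam ⬝ᵥ ((F ^ k) *ᵥ w) := by
  have hT : Fᵀ = F := by
    ext i j
    simpa using hF.apply i j
  have heven : ∀ m : ℕ, 0 ≤ lam ⬝ᵥ ((F ^ (m + m)) *ᵥ w) := by
    intro m
    have h := h1.posSemidef.dotProduct_mulVec_nonneg ((F ^ m) *ᵥ w)
    have hc : (1 - F) * F ^ m = F ^ m * (1 - F) := by
      rw [sub_mul, mul_sub, one_mul, mul_one, ← pow_succ, ← pow_succ']
    have hTm : (F ^ m)ᵀ = F ^ m := by rw [Matrix.transpose_pow, hT]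
    have e : (F ^ m *ᵥ w) ⬝ᵥ ((1 - F) *ᵥ (F ^ m *ᵥ w)) = lam ⬝ᵥ ((F ^ (m + m)) *ᵥ w) := by
      rw [Matrix.mulVec_mulVec, hc, ← Matrix.mulVec_mulVec, hw, Matrix.dotProduct_mulVec,
        ← Matrix.mulVec_transpose, hTm, Matrix.mulVec_mulVec, ← pow_add, dotProduct_comm]
    rw [← e]
    simpa using h
  rcases Nat.even_or_odd' k with ⟨m, rfl | rfl⟩
  · rw [two_mul]; exact heven m
  · have h2 := heven (m + 1)
    have hpos : ∀ k i, 0 ≤ (F ^ k *ᵥ lam) i := by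
      intro k
      induction k with
      | zero => simpa using hl
      | succ k ih =>
        intro i
        rw [pow_succ', ← Matrix.mulVec_mulVec]
        simp only [Matrix.mulVec, dotProduct] at ih ⊢
        exact Finset.sum_nonneg fun j _ => mul_nonneg (hFn i j) (ih j)
    have h3 : 0 ≤ lam ⬝ᵥ (F ^ (2 * m + 1) *ᵥ lam) :=
      Finset.sum_nonneg fun j _ => mul_nonneg (hl j) (hpos _ j)
    have e : F ^ (2 * m + 1) *ᵥ lam = F ^ (2 * m + 1) *ᵥ w - F ^ (m + 1 + (m + 1)) *ᵥ w := by
      have : m + 1 + (m + 1) = 2 * m + 1 + 1 := by ring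
      rw [← hw, Matrix.mulVec_mulVec, mul_sub, mul_one, this, pow_succ _ (2 * m + 1),
        Matrix.sub_mulVec]
    rw [e, dotProduct_sub] at h3
    linarith

lemma aux_sum {N : ℕ} (F : Matrix (Fin N) (Fin N) ℝ) (hFn : ∀ i j, 0 ≤ F i j) (M : ℝ)
    (hM0 : 0 ≤ M) (hM : ∀ j, ∑ i, F i j ≤ M) (s : Fin N → ℝ) (hs : ∀ i, 0 ≤ s i) (k : ℕ) :
    (∀ i, 0 ≤ (F ^ k *ᵥ s) i) ∧ ∑ i, (F ^ k *ᵥ s) i ≤ M ^ k * ∑ i, s i := by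
  induction k with
  | zero => simpa using hs
  | succ k ih =>
    obtain ⟨h1, h2⟩ := ih
    rw [pow_succ', ← Matrix.mulVec_mulVec]
    refine ⟨fun i => ?_, ?_⟩
    · simp only [Matrix.mulVec, dotProduct] at h1 ⊢
      exact Finset.sum_nonneg fun j _ => mul_nonneg (hFn i j) (h1 j)
    calc ∑ i, (F *ᵥ (F ^ k *ᵥ s)) i = ∑ j, (∑ i, F i j) * (F ^ k *ᵥ s) j := by
          simp only [Finset.sum_mul]
          rw [Finset.sum_comm]
          rfl
      _ ≤ ∑ j, M * (F ^ k *ᵥ s) j :=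
          Finset.sum_le_sum fun j _ => mul_le_mul_of_nonneg_right (hM j) (h1 j)
      _ = M * ∑ j, (F ^ k *ᵥ s) j := by rw [Finset.mul_sum]
      _ ≤ M * (M ^ k * ∑ i, s i) := mul_le_mul_of_nonneg_left h2 hM0
      _ = M ^ (k + 1) * ∑ i, s i := by ring

/-- Lemma 2: bound on the propagation of the maximal MSE at the output of the
Deep-LMS between two updates of the preprocessing matrix. With
`F = diag(ρ) + 4μ²λλᵀ` positive definite with eigenvalues `< 1`, the recursion
`S[n+1] = F S[n] + 4μ² λ ε*ᵀ` and `ε[n]ᵀ = 1ᵀ Λ S[n] + ε*ᵀ` satisfy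
`‖ε[n]‖_∞ ≤ (λ_max/λ_min) ‖F‖₁^{n-n₀} ‖ε[n₀]‖_∞ + (1 + 4μ² λᵀ(I-F)⁻¹λ) ‖ε*‖_∞`. -/
theorem stmt_1 (N : ℕ) (hN : 1 ≤ N)
    (lam : Fin N → ℝ) (hlam : ∀ i, 0 < lam i)
    (μ : ℝ) (hμ : 0 < μ)
    (q : ℝ) (hq : q = 1 / 2 ∨ q = 1)
    (ρ : Fin N → ℝ) (hρ : ∀ i, ρ i = 1 - 4 * μ * lam i + 8 * q * μ ^ 2 * lam i ^ 2)
    (hρnn : ∀ i, 0 ≤ ρ i)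
    (F : Matrix (Fin N) (Fin N) ℝ)
    (hF : F = Matrix.diagonal ρ + (4 * μ ^ 2) • Matrix.vecMulVec lam lam)
    (hFpd : F.PosDef)
    (heig : ∀ t ∈ spectrum ℝ F, t < 1)
    (Λ : Matrix (Fin N) (Fin N) ℝ) (hΛ : Λ = Matrix.diagonal lam)
    (εs : Fin N → ℝ) (hεs : ∀ i, 0 ≤ εs i)
    (n₀ : ℕ)
    (S : ℕ → Matrix (Fin N) (Fin N) ℝ) (hSnn : ∀ n i j, 0 ≤ S n i j)
    (hSrec : ∀ n, n₀ ≤ n → S (n + 1) = F * S n + (4 * μ ^ 2) • Matrix.vecMulVec lam εs)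
    (ε : ℕ → Fin N → ℝ)
    (hε : ∀ n j, ε n j = (∑ i, lam i * S n i j) + εs j) :
    ∀ n, n₀ ≤ n →
      univ.sup' ⟨⟨0, by omega⟩, mem_univ _⟩ (fun j => |ε n j|) ≤
        (univ.sup' ⟨⟨0, by omega⟩, mem_univ _⟩ lam /
            univ.inf' ⟨⟨0, by omega⟩, mem_univ _⟩ lam) *
          (univ.sup' ⟨⟨0, by omega⟩, mem_univ _⟩ (fun j => ∑ i, |F i j|)) ^ (n - n₀) *
          univ.sup' ⟨⟨0, by omega⟩, mem_univ _⟩ (fun j => |ε n₀ j|) +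
        (1 + 4 * μ ^ 2 * (lam ⬝ᵥ ((1 - F)⁻¹).mulVec lam)) *
          univ.sup' ⟨⟨0, by omega⟩, mem_univ _⟩ (fun i => |εs i|) := by
  intro n hn
  obtain ⟨k, rfl⟩ := Nat.exists_eq_add_of_le hn
  have hne : (univ : Finset (Fin N)).Nonempty := ⟨⟨0, by omega⟩, mem_univ _⟩
  have hFn : ∀ i j, 0 ≤ F i j := by
    intro i j
    rw [hF]
    have h1 : 0 ≤ Matrix.diagonal ρ i j := by
      rw [Matrix.diagonal_apply]; split_ifs
      · exact hρnn i
      · exact le_rfl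
    have h2 : 0 ≤ 4 * μ ^ 2 * (lam i * lam j) := by
      have := hlam i; have := hlam j; positivity
    simpa [Matrix.vecMulVec_apply] using add_nonneg h1 h2
  have hPD := aux_posDef F hFpd.isHermitian heig
  set w := ((1 - F)⁻¹).mulVec lam with hwdef
  have hw : (1 - F) *ᵥ w = lam := by
    rw [hwdef, Matrix.mulVec_mulVec, Matrix.mul_nonsing_inv _ (Matrix.isUnit_iff_isUnit_det _ |>.1 hPD.isUnit),
      Matrix.one_mulVec]
  have hwF : F *ᵥ w = w - lam := by
    rw [Matrix.sub_mulVec, Matrix.one_mulVec] at hw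
    rw [← hw]; abel
  have hnn := aux_nonneg F hFpd.isHermitian hPD lam w hw (fun i => (hlam i).le) hFn
  rw [Nat.add_sub_cancel_left]
  set M := univ.sup' ⟨⟨0, by omega⟩, mem_univ _⟩ (fun j => ∑ i, |F i j|) with hMdef
  set L := univ.sup' ⟨⟨0, by omega⟩, mem_univ _⟩ lam with hL
  set l := univ.inf' ⟨⟨0, by omega⟩, mem_univ _⟩ lam with hl
  set E := univ.sup' ⟨⟨0, by omega⟩, mem_univ _⟩ (fun j => |ε n₀ j|) with hE
  set Es := univ.sup' ⟨⟨0, by omega⟩, mem_univ _⟩ (fun i => |εs i|) with hEs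
  have hM : ∀ j, ∑ i, F i j ≤ M := fun j =>
    (Finset.sum_le_sum fun i _ => le_abs_self _).trans
      (Finset.le_sup' (fun j => ∑ i, |F i j|) (mem_univ j))
  have hM0 : 0 ≤ M := (Finset.sum_nonneg fun i _ => hFn i ⟨0, by omega⟩).trans (hM _)
  have hLle : ∀ i, lam i ≤ L := fun i => Finset.le_sup' lam (mem_univ i)
  have hlle : ∀ i, l ≤ lam i := fun i => Finset.inf'_le lam (mem_univ i)
  have hlpos : 0 < l := by
    exact (Finset.lt_inf'_iff _).2 fun i _ => hlam i
  have hLpos : 0 < L := (hlam ⟨0, by omega⟩).trans_le (hLle _)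
  apply Finset.sup'_le
  intro j _
  have hεnn : ∀ n, 0 ≤ ε n j := fun n => by
    rw [hε]
    exact add_nonneg (Finset.sum_nonneg fun i _ => mul_nonneg (hlam i).le (hSnn _ _ _)) (hεs j)
  rw [abs_of_nonneg (hεnn _)]
  have hEj : ε n₀ j ≤ E := (le_abs_self _).trans (Finset.le_sup' (fun j => |ε n₀ j|) (mem_univ j))
  have hEsj : εs j ≤ Es := (le_abs_self _).trans (Finset.le_sup' (fun j => |εs j|) (mem_univ j))
  let s : ℕ → Fin N → ℝ := fun n i => S n i j
  set c := 4 * μ ^ 2 * εs j with hc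
  have hc0 : 0 ≤ c := by have := hεs j; positivity
  have hrec : ∀ n, n₀ ≤ n → s (n + 1) = F *ᵥ s n + c • lam := by
    intro n hn
    funext i
    simp only [s, hSrec n hn, Matrix.add_apply, Matrix.smul_apply, Matrix.vecMulVec_apply,
      Matrix.mul_apply, Pi.add_apply, Pi.smul_apply, smul_eq_mul, Matrix.mulVec, dotProduct, hc]
    ring
  have hsol : ∀ k, s (n₀ + k) = F ^ k *ᵥ s n₀ + c • w - c • (F ^ k *ᵥ w) := by
    intro k
    induction k with
    | zero => simp
    | succ k ih =>
      rw [← add_assoc, hrec _ (Nat.le_add_right _ _), ih, Matrix.mulVec_sub, Matrix.mulVec_add,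
        Matrix.mulVec_smul, Matrix.mulVec_smul, hwF, Matrix.mulVec_mulVec, Matrix.mulVec_mulVec,
        ← pow_succ', smul_sub]
      abel
  have hεk : ε (n₀ + k) j = lam ⬝ᵥ s (n₀ + k) + εs j := hε _ _
  have hε0 : ε n₀ j = lam ⬝ᵥ s n₀ + εs j := hε _ _
  obtain ⟨g1, g2⟩ := aux_sum F hFn M hM0 hM (s n₀) (fun i => hSnn _ _ _) k
  have hb1 : lam ⬝ᵥ (F ^ k *ᵥ s n₀) ≤ L * ∑ i, (F ^ k *ᵥ s n₀) i := by
    rw [Finset.mul_sum]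
    exact Finset.sum_le_sum fun i _ => mul_le_mul_of_nonneg_right (hLle i) (g1 i)
  have hb2 : l * ∑ i, s n₀ i ≤ lam ⬝ᵥ s n₀ := by
    rw [Finset.mul_sum]
    exact Finset.sum_le_sum fun i _ => mul_le_mul_of_nonneg_right (hlle i) (hSnn _ _ _)
  have hb3 : ∑ i, s n₀ i ≤ E / l := by
    rw [le_div_iff₀ hlpos]
    have := hεs j
    linarith
  have hb4 : lam ⬝ᵥ (F ^ k *ᵥ s n₀) ≤ L / l * M ^ k * E := by
    calc lam ⬝ᵥ (F ^ k *ᵥ s n₀) ≤ L * (M ^ k * (E / l)) :=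
          hb1.trans (mul_le_mul_of_nonneg_left
            (g2.trans (mul_le_mul_of_nonneg_left hb3 (pow_nonneg hM0 k))) hLpos.le)
      _ = L / l * M ^ k * E := by ring
  have hlw : 0 ≤ lam ⬝ᵥ w := by simpa using hnn 0
  have hb5 : (1 + 4 * μ ^ 2 * (lam ⬝ᵥ w)) * εs j ≤ (1 + 4 * μ ^ 2 * (lam ⬝ᵥ w)) * Es :=
    mul_le_mul_of_nonneg_left hEsj (by positivity)
  have hb6 := mul_nonneg hc0 (hnn k)
  rw [hεk, hsol, dotProduct_sub, dotProduct_add, dotProduct_smul, dotProduct_smul, smul_eq_mul,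
    smul_eq_mul]
  have hb7 : c * (lam ⬝ᵥ w) = 4 * μ ^ 2 * (lam ⬝ᵥ w) * εs j := by rw [hc]; ring
  linarith
end

section
/- Let N ≥ 2, let λ ∈ ℝ^N have positive entries, set T := Σ_i λ_i and μ := 1/(3T), and for q ∈ {1/2, 1} set ρ_i := 1 − 4μλ_i + 8qμ²λ_i² and F := diag(ρ) + 4μ²λλᵀ. Then ‖F‖₁ = 1 − (8/9)·g(λ_min/T), where λ_min := min_i λ_i and g(x) := x − q·x². -/
open Finset Matrix

/-- Lemma 7: closed-form expression for the induced ℓ1 norm (maximum absolute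
column sum) of the MSE propagation matrix `F = diag(ρ) + 4μ²λλᵀ` when
`μ = 1/(3T)` with `T = Σᵢ λᵢ`: `‖F‖₁ = 1 - (8/9) g(λ_min/T)`, `g x = x - q x²`. -/
theorem stmt_8 (N : ℕ) (hN : 2 ≤ N)
    (lam : Fin N → ℝ) (hlam : ∀ i, 0 < lam i)
    (T μ : ℝ) (hT : T = ∑ i, lam i) (hμ : μ = 1 / (3 * T))
    (q : ℝ) (hq : q = 1 / 2 ∨ q = 1)
    (ρ : Fin N → ℝ) (hρ : ∀ i, ρ i = 1 - 4 * μ * lam i + 8 * q * μ ^ 2 * lam i ^ 2)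
    (F : Matrix (Fin N) (Fin N) ℝ)
    (hF : F = Matrix.diagonal ρ + (4 * μ ^ 2) • Matrix.vecMulVec lam lam)
    (g : ℝ → ℝ) (hg : ∀ x, g x = x - q * x ^ 2)
    (lamMin : ℝ) (hlamMin : lamMin = univ.inf' ⟨⟨0, by omega⟩, mem_univ _⟩ lam) :
    univ.sup' ⟨⟨0, by omega⟩, mem_univ _⟩ (fun j => ∑ i, |F i j|) =
      1 - (8 / 9) * g (lamMin / T) := by
  have hne : (univ : Finset (Fin N)).Nonempty := ⟨⟨0, by omega⟩, mem_univ _⟩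
  have hTpos : 0 < T := by
    rw [hT]
    exact Finset.sum_pos (fun i _ => hlam i) hne
  have hμT : μ * T = 1 / 3 := by
    rw [hμ]
    field_simp
  have hx : ∀ i, lam i / T = 3 * (μ * lam i) := by
    intro i
    rw [hμ]
    field_simp
  have hρ0 : ∀ i, 0 ≤ ρ i := by
    intro i
    rw [hρ]
    rcases hq with h | h <;> subst h
    · nlinarith [sq_nonneg (1 - 2 * (μ * lam i))]
    · nlinarith [sq_nonneg (1 - 2 * (μ * lam i)), sq_nonneg (μ * lam i)]
  have hcol : ∀ j, ∑ i, |F i j| = 1 - (8 / 9) * g (lam j / T) := by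
    intro j
    have h1 : ∀ i, |F i j| = (if i = j then ρ i else 0) + 4 * μ ^ 2 * lam j * lam i := by
      intro i
      have h2 : F i j = (if i = j then ρ i else 0) + 4 * μ ^ 2 * lam j * lam i := by
        rw [hF]
        simp only [Matrix.add_apply, Matrix.diagonal_apply, Matrix.smul_apply,
          Matrix.vecMulVec_apply, smul_eq_mul]
        ring
      rw [h2]
      apply abs_of_nonneg
      have h3 : 0 ≤ 4 * μ ^ 2 * lam j * lam i := by
        have := hlam i
        have := hlam j
        positivity
      split_ifs
      · linarith [hρ0 i]
      · linarith
    rw [Finset.sum_congr rfl (fun i _ => h1 i), Finset.sum_add_distrib, ← Finset.mul_sum, ← hT,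
      Finset.sum_ite_eq' univ j ρ, if_pos (mem_univ j), hρ, hg, hx]
    linear_combination (4 * μ * lam j) * hμT
  obtain ⟨m, -, hm⟩ := Finset.exists_mem_eq_inf' hne lam
  have hmin : lamMin = lam m := by rw [hlamMin, hm]
  have hle : ∀ j, lam m ≤ lam j := fun j => by
    rw [← hm]
    exact Finset.inf'_le _ (mem_univ j)
  rw [hmin]
  apply le_antisymm
  · apply Finset.sup'_le
    intro j _
    simp only [hcol]
    by_cases hj : j = m
    · rw [hj]
    · have hs : lam j + lam m ≤ T := by
        rw [hT, ← Finset.sum_pair hj]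
        exact Finset.sum_le_sum_of_subset_of_nonneg (Finset.subset_univ _)
          (fun i _ _ => (hlam i).le)
      have hs' : lam j / T + lam m / T ≤ 1 := by
        rw [← add_div]
        exact (div_le_one hTpos).2 hs
      have hl : lam m / T ≤ lam j / T := by
        have := hle j
        gcongr
      have h0 : 0 < lam m / T := div_pos (hlam m) hTpos
      rw [hg, hg]
      generalize lam j / T = y at *
      generalize lam m / T = x at *
      have hk : 0 ≤ (y - x) * (1 - q * (y + x)) := by
        apply mul_nonneg (by linarith)
        rcases hq with h | h <;> subst h <;> linarith
      nlinarith
  · rw [← hcol m]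
    exact Finset.le_sup' (fun j => ∑ i, |F i j|) (mem_univ m)
end

section
/- Let N ≥ 2, let λ ∈ ℝ^N have positive entries, set T := Σ_i λ_i and μ := 1/(3T), and for q ∈ {1/2, 1} set ρ_i := 1 − 4μλ_i + 8qμ²λ_i² and F := diag(ρ) + 4μ²λλᵀ. Then every eigenvalue of the symmetric matrix F has absolute value strictly less than 1. -/
open Finset Matrix

/-- Observation 1: for step size `μ = 1/(3T)`, every eigenvalue of the symmetric
MSE propagation matrix `F = diag(ρ) + 4μ²λλᵀ` has absolute value strictly
less than `1`, both for real LMS (`q = 1`) and complex LMS (`q = 1/2`). -/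
theorem stmt_9 (N : ℕ) (hN : 2 ≤ N)
    (lam : Fin N → ℝ) (hlam : ∀ i, 0 < lam i)
    (T μ : ℝ) (hT : T = ∑ i, lam i) (hμ : μ = 1 / (3 * T))
    (q : ℝ) (hq : q = 1 / 2 ∨ q = 1)
    (ρ : Fin N → ℝ) (hρ : ∀ i, ρ i = 1 - 4 * μ * lam i + 8 * q * μ ^ 2 * lam i ^ 2)
    (F : Matrix (Fin N) (Fin N) ℝ)
    (hF : F = Matrix.diagonal ρ + (4 * μ ^ 2) • Matrix.vecMulVec lam lam) :
    ∀ t ∈ spectrum ℝ F, |t| < 1 := by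
  intro t ht
  have hev : Module.End.HasEigenvalue (Matrix.toLin' F) t := by
    rw [Module.End.hasEigenvalue_iff_mem_spectrum, Matrix.spectrum_toLin']
    exact ht
  obtain ⟨k, hk⟩ := eigenvalue_mem_ball hev
  rw [Metric.mem_closedBall, Real.dist_eq] at hk
  have hlt : lam k < T := by
    have : Nontrivial (Fin N) := Fin.nontrivial_iff_two_le.mpr hN
    obtain ⟨j, hj⟩ := exists_ne k
    rw [hT]
    exact Finset.single_lt_sum hj (Finset.mem_univ k) (Finset.mem_univ j) (hlam j)
      (fun i _ _ => (hlam i).le)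
  have hTpos : 0 < T := (hlam k).trans hlt
  have hμT : μ * T = 1 / 3 := by
    rw [hμ]; field_simp
  have hμpos : 0 < μ := by rw [hμ]; positivity
  have hoff : ∑ j ∈ Finset.univ.erase k, ‖F k j‖ = 4 * μ ^ 2 * lam k * (T - lam k) := by
    have h1 : ∀ j ∈ Finset.univ.erase k, ‖F k j‖ = 4 * μ ^ 2 * lam k * lam j := by
      intro j hj
      have hne : k ≠ j := (Finset.ne_of_mem_erase hj).symm
      have h2 : F k j = 4 * μ ^ 2 * lam k * lam j := by
        rw [hF]
        simp [Matrix.diagonal_apply_ne _ hne, Matrix.vecMulVec_apply]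
        ring
      have := hlam k
      have := hlam j
      rw [h2, Real.norm_of_nonneg (by positivity)]
    rw [Finset.sum_congr rfl h1, ← Finset.mul_sum, hT,
      ← Finset.add_sum_erase _ lam (Finset.mem_univ k)]
    ring
  have hdiag : F k k = ρ k + 4 * μ ^ 2 * lam k * lam k := by
    rw [hF]
    simp [Matrix.vecMulVec_apply]
    ring
  rw [hoff, hdiag, hρ k] at hk
  obtain ⟨y, hy⟩ : ∃ y, y = μ * lam k := ⟨_, rfl⟩
  have hy0 : 0 < y := by rw [hy]; exact mul_pos hμpos (hlam k)
  have hy1 : y < 1 / 3 := by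
    rw [hy, ← hμT]; exact mul_lt_mul_of_pos_left hlt hμpos
  have e1 : 1 - 4 * μ * lam k + 8 * q * μ ^ 2 * lam k ^ 2 + 4 * μ ^ 2 * lam k * lam k
      = 1 - 4 * y + 8 * q * y ^ 2 + 4 * y ^ 2 := by rw [hy]; ring
  have e2 : 4 * μ ^ 2 * lam k * (T - lam k) = 4 * y * (1 / 3) - 4 * y ^ 2 := by
    rw [hy, ← hμT]; ring
  rw [e1, e2, abs_le] at hk
  obtain ⟨ha, hb⟩ := hk
  rw [abs_lt]
  rcases hq with rfl | rfl
  · constructor <;> nlinarith [mul_pos hy0 (sub_pos.mpr hy1)]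
  · constructor <;> nlinarith [mul_pos hy0 (sub_pos.mpr hy1)]
end

section
/- Let ε and ω be real numbers with 0 < ω < 1, ε < 1, and (1−ω)² < ε. Then ω²/(ε − (1−ω)²) ≥ ε⁻¹ − 1, with equality when ω = 1−ε. -/
/-- Minimization step in the proof of Lemma 5(b): for `0 < ω < 1`, `ε < 1` and
`(1-ω)² < ε`, we have `ω²/(ε - (1-ω)²) ≥ ε⁻¹ - 1`, with equality at `ω = 1 - ε`. -/
theorem stmt_17 (ε ω : ℝ) (hω0 : 0 < ω) (hω1 : ω < 1) (hε1 : ε < 1)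
    (hden : (1 - ω) ^ 2 < ε) :
    ε⁻¹ - 1 ≤ ω ^ 2 / (ε - (1 - ω) ^ 2) ∧
      (ω = 1 - ε → ω ^ 2 / (ε - (1 - ω) ^ 2) = ε⁻¹ - 1) := by
  have hε : 0 < ε := lt_of_le_of_lt (sq_nonneg _) hden
  have hd : 0 < ε - (1 - ω) ^ 2 := by linarith
  have he : ε⁻¹ - 1 = (1 - ε) / ε := by
    rw [sub_div, div_self hε.ne', one_div]
  rw [he]
  constructor
  · rw [div_le_div_iff₀ hε hd]
    nlinarith [sq_nonneg (1 - ω - ε)]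
  · intro h
    rw [div_eq_div_iff hd.ne' hε.ne']
    subst h
    ring
end
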